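/- arXiv:1609.07467 — 2 statements merged into one kernel-verified Lean document; each statement's English description precedes it below -/
import Mathlib

section
/- Strong form of the radial weak formulation: Let f : (0,∞) → [0,∞) be measurable with ess sup_{r>0} f(r)r² < ∞ and with finite line-moments m_j⟨f⟩ for all 0 ≤ j ≤ N+8, and let φ : (0,∞) → ℝ be measurable with |φ(r)| ≤ C(1+r^N) for some C > 0 and integer N ≥ 0. Then ∫₀^∞ 𝒬[f](r) φ(r) dr = 8π² ∫₀^∞∫₀^∞ K(x,y) [f(x)f(y) − f(x)f(x+y) − f(y)f(x+y) − f(x+y)] · [φ(x+y) − φ(x) − φ(y)] dx dy, both sides being absolutely convergent. -/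
open MeasureTheory Set Real Filter

/-- The collision kernel `K(x,y) = x²y²(x+y)²`. -/
noncomputable def Kker (x y : ℝ) : ℝ := x ^ 2 * y ^ 2 * (x + y) ^ 2

/-- The `k`-th line-moment `m_k⟨f⟩ = ∫₀^∞ f(r) r^k dr`. -/
noncomputable def lm (f : ℝ → ℝ) (k : ℝ) : ℝ := ∫ r in Ioi (0 : ℝ), f r * r ^ k

/-- Quadratic part of the radial collision operator (polar Jacobian included). -/
noncomputable def Qq (f : ℝ → ℝ) (r : ℝ) : ℝ :=
  8 * π ^ 2 *
    ((∫ s in (0 : ℝ)..r, Kker s (r - s) * f s * f (r - s)) +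
      2 * (∫ s in Ioi r, Kker r (s - r) * f s * f (s - r)) +
      2 * f r *
        ((∫ s in Ioi r, Kker r (s - r) * f s) -
          (∫ s in (0 : ℝ)..r, Kker s (r - s) * f s) -
          (∫ s in Ioi (0 : ℝ), Kker r s * f s)))

/-- Linear part of the radial collision operator (polar Jacobian included). -/
noncomputable def Lop (f : ℝ → ℝ) (r : ℝ) : ℝ :=
  8 * π ^ 2 *
    (2 * (∫ s in Ioi r, Kker r (s - r) * f s) -
      f r * (∫ s in (0 : ℝ)..r, Kker s (r - s)))

/-- The full radial collision operator `𝒬[f] = Q_q[f] + L[f]`. -/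
noncomputable def Qcol (f : ℝ → ℝ) (r : ℝ) : ℝ := Qq f r + Lop f r

/-- The constant `κ₀ = 9/(64 π² m)`. -/
noncomputable def kappa0 (mass : ℝ) : ℝ := 9 / (64 * π ^ 2 * mass)


/-- The open positive quadrant. -/
def quadrant : Set (ℝ × ℝ) := Ioi (0 : ℝ) ×ˢ Ioi (0 : ℝ)

theorem measurableSet_quadrant : MeasurableSet quadrant :=
  measurableSet_Ioi.prod measurableSet_Ioi

theorem volume_restrict_quadrant :
    (volume : Measure (ℝ × ℝ)).restrict quadrant =
      (volume.restrict (Ioi (0 : ℝ))).prod (volume.restrict (Ioi (0 : ℝ))) := by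
  rw [quadrant, Measure.volume_eq_prod, Measure.prod_restrict]

/-- Fubini on the quadrant, with the first coordinate outside. -/
theorem fubini_quadrant {H : ℝ × ℝ → ℝ} (hH : IntegrableOn H quadrant) :
    IntegrableOn (fun r => ∫ s in Ioi (0 : ℝ), H (r, s)) (Ioi 0) ∧
      ∫ r in Ioi (0 : ℝ), ∫ s in Ioi (0 : ℝ), H (r, s) = ∫ q in quadrant, H q := by
  rw [IntegrableOn, volume_restrict_quadrant] at hH
  rw [volume_restrict_quadrant]
  exact ⟨hH.integral_prod_left, (integral_prod H hH).symm⟩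

theorem integral_Ioi_comp_sub (g : ℝ → ℝ) (r : ℝ) :
    ∫ s in Ioi r, g (s - r) = ∫ s in Ioi (0 : ℝ), g s := by
  rw [← integral_indicator measurableSet_Ioi, ← integral_indicator measurableSet_Ioi,
    ← integral_sub_right_eq_self ((Ioi (0 : ℝ)).indicator g) r]
  congr 1 with s
  simp [indicator]

/-- Fubini on the quadrant in the coordinates `(x, x + y)`, with `x` outside. -/
theorem fubini_quadrant_Ioi {H : ℝ × ℝ → ℝ} (hH : IntegrableOn H quadrant) :
    IntegrableOn (fun r => ∫ s in Ioi r, H (r, s - r)) (Ioi 0) ∧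
      ∫ r in Ioi (0 : ℝ), ∫ s in Ioi r, H (r, s - r) = ∫ q in quadrant, H q := by
  have h (r : ℝ) : ∫ s in Ioi r, H (r, s - r) = ∫ s in Ioi (0 : ℝ), H (r, s) :=
    integral_Ioi_comp_sub (fun s => H (r, s)) r
  simp only [h]
  exact fubini_quadrant hH

theorem measurePreserving_snd_sub :
    MeasurePreserving (fun p : ℝ × ℝ => (p.2, p.1 - p.2)) := by
  simpa only [Measure.volume_eq_prod] using!
    measurePreserving_prod_sub_swap (volume : Measure ℝ) (volume : Measure ℝ)

theorem integral_indicator_quadrant_antidiagonal (H : ℝ × ℝ → ℝ) (r : ℝ) :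
    ∫ s, quadrant.indicator H (s, r - s) =
      (Ioi (0 : ℝ)).indicator (fun r => ∫ s in (0 : ℝ)..r, H (s, r - s)) r := by
  have h : (fun s => quadrant.indicator H (s, r - s)) =
      (Ioo 0 r).indicator (fun s => H (s, r - s)) := by
    ext s
    simp [indicator, quadrant]
  rw [h, integral_indicator measurableSet_Ioo]
  by_cases hr : 0 < r
  · rw [indicator_of_mem (mem_Ioi.2 hr), intervalIntegral.integral_of_le hr.le,
      integral_Ioc_eq_integral_Ioo]
  · rw [indicator_of_notMem (by simpa using hr), Ioo_eq_empty hr]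
    simp

/-- Fubini on the quadrant in the coordinates `(x, x + y)`, with `x + y` outside. -/
theorem fubini_quadrant_antidiagonal {H : ℝ × ℝ → ℝ} (hH : IntegrableOn H quadrant) :
    IntegrableOn (fun r => ∫ s in (0 : ℝ)..r, H (s, r - s)) (Ioi 0) ∧
      ∫ r in Ioi (0 : ℝ), ∫ s in (0 : ℝ)..r, H (s, r - s) = ∫ q in quadrant, H q := by
  have hE : Integrable (quadrant.indicator H) :=
    (integrable_indicator_iff measurableSet_quadrant).2 hH
  have hT : Integrable (fun p : ℝ × ℝ => quadrant.indicator H (p.2, p.1 - p.2)) :=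
    measurePreserving_snd_sub.integrable_comp_of_integrable hE
  have hI : ∫ p : ℝ × ℝ, quadrant.indicator H (p.2, p.1 - p.2) = ∫ q in quadrant, H q := by
    have h := integral_map measurePreserving_snd_sub.measurable.aemeasurable
      (measurePreserving_snd_sub.map_eq.symm ▸ hE.aestronglyMeasurable)
    rw [measurePreserving_snd_sub.map_eq, integral_indicator measurableSet_quadrant] at h
    exact h.symm
  rw [Measure.volume_eq_prod] at hT
  have hL := hT.integral_prod_left
  rw [← hI, Measure.volume_eq_prod, integral_prod _ hT]
  simp only [integral_indicator_quadrant_antidiagonal] at hL ⊢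
  exact ⟨(integrable_indicator_iff measurableSet_Ioi).1 hL,
    (integral_indicator measurableSet_Ioi).symm⟩

theorem integral_quadrant_swap {H : ℝ × ℝ → ℝ} :
    ∫ q in quadrant, H q.swap = ∫ q in quadrant, H q := by
  rw [volume_restrict_quadrant]
  exact integral_prod_swap H

theorem integrableOn_quadrant_swap {H : ℝ × ℝ → ℝ} (hH : IntegrableOn H quadrant) :
    IntegrableOn (fun q => H q.swap) quadrant := by
  rw [IntegrableOn, volume_restrict_quadrant] at hH ⊢
  exact hH.swap

/-- If `h` and `k` are integrable on the half-line then `(x, y) ↦ h x * k (x + y)` is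
integrable on the quadrant. -/
theorem integrableOn_quadrant_mul_add {h k : ℝ → ℝ} (hh : IntegrableOn h (Ioi 0))
    (hk : IntegrableOn k (Ioi 0)) :
    IntegrableOn (fun q : ℝ × ℝ => h q.1 * k (q.1 + q.2)) quadrant := by
  have hP : Integrable (fun p : ℝ × ℝ => (Ioi 0).indicator h p.1 * (Ioi 0).indicator k p.2) :=
    ((integrable_indicator_iff measurableSet_Ioi).2 hh).mul_prod
      ((integrable_indicator_iff measurableSet_Ioi).2 hk)
  have hS : MeasurePreserving (fun p : ℝ × ℝ => (p.1, p.1 + p.2)) := by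
    simpa only [Measure.volume_eq_prod] using!
      measurePreserving_prod_add (volume : Measure ℝ) (volume : Measure ℝ)
  refine (hS.integrable_comp_of_integrable hP).integrableOn.congr_fun (fun q hq => ?_)
    measurableSet_quadrant
  obtain ⟨hx, hy⟩ := hq
  rw [mem_Ioi] at hx hy
  simp [indicator, hx, add_pos hx hy]

theorem integrableOn_quadrant_mul {h k : ℝ → ℝ} (hh : IntegrableOn h (Ioi 0))
    (hk : IntegrableOn k (Ioi 0)) :
    IntegrableOn (fun q : ℝ × ℝ => h q.1 * k q.2) quadrant := by
  rw [IntegrableOn, volume_restrict_quadrant]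
  exact hh.mul_prod hk

theorem measurable_Kker : Measurable (fun q : ℝ × ℝ => Kker q.1 q.2) := by
  unfold Kker
  fun_prop

theorem Kker_comm (x y : ℝ) : Kker x y = Kker y x := by
  unfold Kker
  ring

theorem Kker_nonneg (x y : ℝ) : 0 ≤ Kker x y := by
  unfold Kker
  positivity

theorem Kker_le {x y : ℝ} (hx : 0 ≤ x) (hy : 0 ≤ y) : Kker x y ≤ (1 + (x + y)) ^ 6 := by
  have h : Kker x y ≤ (1 + (x + y)) ^ 2 * (1 + (x + y)) ^ 2 * (1 + (x + y)) ^ 2 := by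
    unfold Kker
    have h1 : x ≤ 1 + (x + y) := by linarith
    have h2 : y ≤ 1 + (x + y) := by linarith
    have h3 : x + y ≤ 1 + (x + y) := by linarith
    gcongr
  exact h.trans_eq (by ring)

theorem integrableOn_mul_one_add_pow {f : ℝ → ℝ} {n : ℕ}
    (hf : ∀ j ≤ n, IntegrableOn (fun r => f r * r ^ j) (Ioi 0)) :
    IntegrableOn (fun r => f r * (1 + r) ^ n) (Ioi 0) := by
  have h : (fun r => f r * (1 + r) ^ n) =
      fun r => ∑ k ∈ Finset.range (n + 1), f r * r ^ k * (n.choose k : ℝ) := by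
    ext r
    rw [add_comm, add_pow, Finset.mul_sum]
    exact Finset.sum_congr rfl fun k _ => by ring
  rw [h]
  exact integrable_finsetSum _ fun k hk =>
    (hf k (Nat.lt_succ_iff.1 (Finset.mem_range.1 hk))).mul_const _

/-- Integrability of `K F ψ` when `ψ` grows at most like `(x + y) ^ N` and the weight `F` has
enough moments. -/
theorem integrableOn_quadrant_Kker_mul {F ψ : ℝ × ℝ → ℝ} {N : ℕ} {C : ℝ}
    (hF0 : ∀ q ∈ quadrant, 0 ≤ F q) (hFm : Measurable F) (hψm : Measurable ψ)
    (hF : IntegrableOn (fun q => F q * (1 + (q.1 + q.2)) ^ (N + 6)) quadrant)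
    (hψ : ∀ q ∈ quadrant, |ψ q| ≤ C * (1 + (q.1 + q.2)) ^ N) :
    IntegrableOn (fun q => Kker q.1 q.2 * F q * ψ q) quadrant := by
  refine Integrable.mono' (hF.const_mul C)
    ((measurable_Kker.mul hFm).mul hψm).aestronglyMeasurable ?_
  refine (ae_restrict_iff' measurableSet_quadrant).2 (Eventually.of_forall fun q hq => ?_)
  have hK := Kker_le (le_of_lt hq.1) (le_of_lt hq.2)
  have hx : 0 < q.1 := hq.1
  have hy : 0 < q.2 := hq.2
  rw [Real.norm_eq_abs, abs_mul, abs_mul, abs_of_nonneg (Kker_nonneg _ _),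
    abs_of_nonneg (hF0 q hq)]
  calc Kker q.1 q.2 * F q * |ψ q|
      ≤ (1 + (q.1 + q.2)) ^ 6 * F q * (C * (1 + (q.1 + q.2)) ^ N) := by
        have := hF0 q hq
        exact mul_le_mul (mul_le_mul_of_nonneg_right hK this) (hψ q hq) (abs_nonneg _)
          (by positivity)
    _ = _ := by ring

theorem integrableOn_quadrant_weight_mul {f : ℝ → ℝ} {n : ℕ} (hfm : Measurable f)
    (hf0 : ∀ r, 0 ≤ f r) (hf : IntegrableOn (fun r => f r * (1 + r) ^ n) (Ioi 0)) :
    IntegrableOn (fun q : ℝ × ℝ => f q.1 * f q.2 * (1 + (q.1 + q.2)) ^ n) quadrant := by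
  refine Integrable.mono' (integrableOn_quadrant_mul hf hf)
    (Measurable.aestronglyMeasurable (by fun_prop)) ?_
  refine (ae_restrict_iff' measurableSet_quadrant).2 (Eventually.of_forall fun q hq => ?_)
  have hx : 0 < q.1 := hq.1
  have hy : 0 < q.2 := hq.2
  have h1 := hf0 q.1
  have h2 := hf0 q.2
  rw [Real.norm_of_nonneg (by positivity)]
  calc f q.1 * f q.2 * (1 + (q.1 + q.2)) ^ n
      ≤ f q.1 * f q.2 * ((1 + q.1) * (1 + q.2)) ^ n := by
        gcongr
        nlinarith [mul_pos hx hy]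
    _ = _ := by rw [mul_pow]; ring

theorem integrableOn_quadrant_weight_add {f : ℝ → ℝ} {n : ℕ} (hfm : Measurable f)
    (hf0 : ∀ r, 0 ≤ f r) (hf : IntegrableOn (fun r => f r * (1 + r) ^ (n + 2)) (Ioi 0)) :
    IntegrableOn (fun q : ℝ × ℝ => f (q.1 + q.2) * (1 + (q.1 + q.2)) ^ n) quadrant := by
  refine Integrable.mono' (integrableOn_quadrant_mul_add
    (integrable_inv_one_add_sq.integrableOn (s := Ioi 0)) hf)
    (Measurable.aestronglyMeasurable (by fun_prop)) ?_
  refine (ae_restrict_iff' measurableSet_quadrant).2 (Eventually.of_forall fun q hq => ?_)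
  have hx : 0 < q.1 := hq.1
  have hy : 0 < q.2 := hq.2
  have h1 := hf0 (q.1 + q.2)
  rw [Real.norm_of_nonneg (by positivity), inv_mul_eq_div, le_div_iff₀ (by positivity),
    pow_add, ← mul_assoc]
  gcongr
  nlinarith [mul_pos hx hy, sq_nonneg q.2]

theorem integrable_and_integral_combination {α : Type*} [MeasurableSpace α] {μ : Measure α}
    {a b c d e u v : α → ℝ} (ha : Integrable a μ) (hb : Integrable b μ) (hc : Integrable c μ)
    (hd : Integrable d μ) (he : Integrable e μ) (hu : Integrable u μ) (hv : Integrable v μ) :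
    Integrable (fun t => a t / 2 - b t - c t + d t + e t - u t / 2 + v t) μ ∧
      ∫ t, (a t / 2 - b t - c t + d t + e t - u t / 2 + v t) ∂μ =
        (∫ t, a t ∂μ) / 2 - (∫ t, b t ∂μ) - (∫ t, c t ∂μ) + (∫ t, d t ∂μ) + (∫ t, e t ∂μ)
          - (∫ t, u t ∂μ) / 2 + ∫ t, v t ∂μ := by
  have h1 : Integrable (fun t => a t / 2 - b t) μ := (ha.div_const 2).sub hb
  have h2 : Integrable (fun t => a t / 2 - b t - c t) μ := h1.sub hc
  have h3 : Integrable (fun t => a t / 2 - b t - c t + d t) μ := h2.add hd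
  have h4 : Integrable (fun t => a t / 2 - b t - c t + d t + e t) μ := h3.add he
  have h5 : Integrable (fun t => a t / 2 - b t - c t + d t + e t - u t / 2) μ :=
    h4.sub (hu.div_const 2)
  refine ⟨h5.add hv, ?_⟩
  rw [integral_add h5 hv, integral_sub h4 (hu.div_const 2), integral_add h3 he,
    integral_add h2 hd, integral_sub h1 hc, integral_sub (ha.div_const 2) hb,
    integral_div, integral_div]

/-- Strong form of the radial weak formulation. -/
theorem radial_weak_formulation (f φ : ℝ → ℝ) (hfmeas : Measurable f) (hf0 : ∀ r, 0 ≤ f r)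
    (M : ℝ) (hM : ∀ᵐ r ∂(volume.restrict (Ioi (0 : ℝ))), f r * r ^ 2 ≤ M)
    (N : ℕ)
    (hmom : ∀ j : ℕ, j ≤ N + 8 → IntegrableOn (fun r => f r * r ^ j) (Ioi (0 : ℝ)))
    (hφmeas : Measurable φ) (C : ℝ) (hC : 0 < C)
    (hφ : ∀ r ∈ Ioi (0 : ℝ), |φ r| ≤ C * (1 + r ^ N)) :
    IntegrableOn (fun r => Qcol f r * φ r) (Ioi (0 : ℝ)) ∧
    IntegrableOn
      (fun q : ℝ × ℝ =>
        Kker q.1 q.2 *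
          (f q.1 * f q.2 - f q.1 * f (q.1 + q.2) - f q.2 * f (q.1 + q.2) - f (q.1 + q.2)) *
          (φ (q.1 + q.2) - φ q.1 - φ q.2))
      (Ioi (0 : ℝ) ×ˢ Ioi (0 : ℝ)) ∧
    (∫ r in Ioi (0 : ℝ), Qcol f r * φ r) =
      8 * π ^ 2 *
        ∫ q in Ioi (0 : ℝ) ×ˢ Ioi (0 : ℝ),
          Kker q.1 q.2 *
            (f q.1 * f q.2 - f q.1 * f (q.1 + q.2) - f q.2 * f (q.1 + q.2) - f (q.1 + q.2)) *
            (φ (q.1 + q.2) - φ q.1 - φ q.2) := by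
  have hf6 : IntegrableOn (fun r => f r * (1 + r) ^ (N + 6)) (Ioi 0) :=
    integrableOn_mul_one_add_pow fun j hj => hmom j (by omega)
  have hf1 : IntegrableOn f (Ioi 0) := by simpa using hmom 0 (by omega)
  have hφs (z s : ℝ) (hz : 0 < z) (hzs : z ≤ s) : |φ z| ≤ 2 * C * (1 + s) ^ N := by
    have h1 : (1 : ℝ) ≤ (1 + s) ^ N := one_le_pow₀ (by linarith)
    have h2 : z ^ N ≤ (1 + s) ^ N := by gcongr; linarith
    calc |φ z| ≤ C * (1 + z ^ N) := hφ z hz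
      _ ≤ C * ((1 + s) ^ N + (1 + s) ^ N) := by gcongr
      _ = _ := by ring
  have hψ1 : ∀ q ∈ quadrant, |φ (q.1 + q.2)| ≤ 2 * C * (1 + (q.1 + q.2)) ^ N := fun q hq =>
    hφs _ _ (add_pos hq.1 hq.2) le_rfl
  have hψ2 : ∀ q ∈ quadrant, |φ q.1| ≤ 2 * C * (1 + (q.1 + q.2)) ^ N := fun q hq =>
    hφs _ _ hq.1 (le_add_of_nonneg_right (le_of_lt hq.2))
  have hW1 := integrableOn_quadrant_weight_mul hfmeas hf0 hf6
  have hW2 : IntegrableOn (fun q : ℝ × ℝ =>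
      f q.1 * f (q.1 + q.2) * (1 + (q.1 + q.2)) ^ (N + 6)) quadrant := by
    simpa only [mul_assoc] using integrableOn_quadrant_mul_add hf1 hf6
  have hW3 : IntegrableOn (fun q : ℝ × ℝ =>
      f q.2 * f (q.1 + q.2) * (1 + (q.1 + q.2)) ^ (N + 6)) quadrant := by
    simpa only [Prod.fst_swap, Prod.snd_swap, add_comm] using integrableOn_quadrant_swap hW2
  have hW4 := integrableOn_quadrant_weight_add hfmeas hf0 (n := N + 6)
    (integrableOn_mul_one_add_pow hmom)
  have hA := integrableOn_quadrant_Kker_mul (ψ := fun q => φ (q.1 + q.2))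
    (fun q _ => mul_nonneg (hf0 _) (hf0 _)) (by fun_prop) (by fun_prop) hW1 hψ1
  have hB := integrableOn_quadrant_Kker_mul (ψ := fun q => φ q.1)
    (fun q _ => mul_nonneg (hf0 _) (hf0 _)) (by fun_prop) (by fun_prop) hW1 hψ2
  have hG := integrableOn_quadrant_Kker_mul (ψ := fun q => φ (q.1 + q.2))
    (fun q _ => mul_nonneg (hf0 _) (hf0 _)) (by fun_prop) (by fun_prop) hW2 hψ1
  have hD := integrableOn_quadrant_Kker_mul (ψ := fun q => φ q.1)
    (fun q _ => mul_nonneg (hf0 _) (hf0 _)) (by fun_prop) (by fun_prop) hW2 hψ2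
  have hD' := integrableOn_quadrant_Kker_mul (ψ := fun q => φ q.1)
    (fun q _ => mul_nonneg (hf0 _) (hf0 _)) (by fun_prop) (by fun_prop) hW3 hψ2
  have hE := integrableOn_quadrant_Kker_mul (ψ := fun q => φ (q.1 + q.2))
    (fun q _ => hf0 _) (by fun_prop) (by fun_prop) hW4 hψ1
  have hE' := integrableOn_quadrant_Kker_mul (ψ := fun q => φ q.1)
    (fun q _ => hf0 _) (by fun_prop) (by fun_prop) hW4 hψ2
  -- the weak-form integrand is `R q + R q.swap`
  set R : ℝ × ℝ → ℝ := fun q =>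
    Kker q.1 q.2 * (f q.1 * f q.2) * φ (q.1 + q.2) / 2
      - Kker q.1 q.2 * (f q.1 * f q.2) * φ q.1
      - Kker q.1 q.2 * (f q.1 * f (q.1 + q.2)) * φ (q.1 + q.2)
      + Kker q.1 q.2 * (f q.1 * f (q.1 + q.2)) * φ q.1
      + Kker q.1 q.2 * (f q.2 * f (q.1 + q.2)) * φ q.1
      - Kker q.1 q.2 * f (q.1 + q.2) * φ (q.1 + q.2) / 2
      + Kker q.1 q.2 * f (q.1 + q.2) * φ q.1 with hRdef
  obtain ⟨hR, eR⟩ := integrable_and_integral_combination hA hB hG hD hD' hE hE'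
  change IntegrableOn R quadrant at hR
  change ∫ q in quadrant, R q = _ at eR
  have hsplit : (fun q : ℝ × ℝ => Kker q.1 q.2 *
      (f q.1 * f q.2 - f q.1 * f (q.1 + q.2) - f q.2 * f (q.1 + q.2) - f (q.1 + q.2)) *
      (φ (q.1 + q.2) - φ q.1 - φ q.2)) = fun q => R q + R q.swap := by
    ext ⟨x, y⟩
    simp only [hRdef, Prod.swap_prod_mk, Kker_comm y x, add_comm y x]
    ring
  clear_value R
  obtain ⟨iA, eA⟩ := fubini_quadrant_antidiagonal hA
  obtain ⟨iB, eB⟩ := fubini_quadrant hB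
  obtain ⟨iG, eG⟩ := fubini_quadrant_antidiagonal hG
  obtain ⟨iD, eD⟩ := fubini_quadrant_Ioi hD
  obtain ⟨iD', eD'⟩ := fubini_quadrant_Ioi hD'
  obtain ⟨iE, eE⟩ := fubini_quadrant_antidiagonal hE
  obtain ⟨iE', eE'⟩ := fubini_quadrant_Ioi hE'
  have hI := integrable_and_integral_combination iA iB iG iD iD' iE iE'
  have hQ : (fun r => Qcol f r * φ r) = fun r => 8 * π ^ 2 * 2 *
      ((∫ s in (0 : ℝ)..r, Kker s (r - s) * (f s * f (r - s)) * φ (s + (r - s))) / 2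
        - (∫ s in Ioi (0 : ℝ), Kker r s * (f r * f s) * φ r)
        - (∫ s in (0 : ℝ)..r, Kker s (r - s) * (f s * f (s + (r - s))) * φ (s + (r - s)))
        + (∫ s in Ioi r, Kker r (s - r) * (f r * f (r + (s - r))) * φ r)
        + (∫ s in Ioi r, Kker r (s - r) * (f (s - r) * f (r + (s - r))) * φ r)
        - (∫ s in (0 : ℝ)..r, Kker s (r - s) * f (s + (r - s)) * φ (s + (r - s))) / 2
        + ∫ s in Ioi r, Kker r (s - r) * f (r + (s - r)) * φ r) := by
    ext r
    have e1 : ∫ s in Ioi (0 : ℝ), Kker r s * (f r * f s) =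
        f r * ∫ s in Ioi (0 : ℝ), Kker r s * f s := by
      rw [← integral_const_mul]; congr 1 with s; ring
    have e2 : ∫ s in Ioi r, Kker r (s - r) * (f r * f s) =
        f r * ∫ s in Ioi r, Kker r (s - r) * f s := by
      rw [← integral_const_mul]; congr 1 with s; ring
    have e3 : ∫ s in (0 : ℝ)..r, Kker s (r - s) * (f s * f r) =
        f r * ∫ s in (0 : ℝ)..r, Kker s (r - s) * f s := by
      rw [← intervalIntegral.integral_const_mul]; congr 1 with s; ring
    have e5 : ∫ s in (0 : ℝ)..r, Kker s (r - s) * (f s * f (r - s)) =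
        ∫ s in (0 : ℝ)..r, Kker s (r - s) * f s * f (r - s) := by
      congr 1 with s; ring
    have e4 : ∫ s in Ioi r, Kker r (s - r) * (f (s - r) * f s) =
        ∫ s in Ioi r, Kker r (s - r) * f s * f (s - r) := by
      congr 1 with s; ring
    simp only [add_sub_cancel, integral_mul_const, intervalIntegral.integral_mul_const,
      e1, e2, e3, e4, e5, Qcol, Qq, Lop]
    ring
  refine ⟨?_, ?_, ?_⟩
  · rw [hQ]
    exact hI.1.const_mul _
  · rw [hsplit]
    exact hR.add (integrableOn_quadrant_swap hR)
  · change _ = _ * ∫ q in quadrant, _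
    have e := hI.2
    rw [eA, eB, eG, eD, eD', eE, eE', ← eR] at e
    rw [hsplit, integral_add hR (integrableOn_quadrant_swap hR), integral_quadrant_swap, hQ,
      integral_const_mul]
    refine (congrArg (8 * π ^ 2 * 2 * ·) e).trans ?_
    ring
end

section
/- Pointwise bounds on the collision operator: Let f : (0,∞) → [0,∞) be measurable with m₃⟨f⟩ < ∞, m₄⟨f⟩ < ∞ and M := ess sup_{r>0} f(r)r² < ∞. Then for a.e. r > 0: Q_q[f](r) ≤ 8π² ( 2 m₃⟨f⟩ · r · M − 4 m₃⟨f⟩ · r³ f(r) ), and L[f](r) ≤ 8π² ( 2 m₄⟨f⟩ · r² − c₀ · r⁷ f(r) ), where c₀ := ∫₀¹ z²(1−z)² dz = 1/30. -/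
open MeasureTheory Set Real Filter

/-- Reflection symmetry `s ↦ r - s` of a density on `(0, r)` lets one weight it by `2 s / r`. -/
theorem mul_integral_eq_two_mul_integral_id_mul_of_symm {g : ℝ → ℝ} {r : ℝ}
    (hg : IntervalIntegrable g volume 0 r) (hsymm : ∀ s, g (r - s) = g s) :
    r * (∫ s in (0 : ℝ)..r, g s) = 2 * ∫ s in (0 : ℝ)..r, s * g s := by
  have hid : IntervalIntegrable (fun s => s * g s) volume 0 r :=
    hg.continuousOn_mul continuousOn_id
  have hrefl : ∫ s in (0 : ℝ)..r, (r - s) * g s = ∫ s in (0 : ℝ)..r, s * g s := by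
    have h := intervalIntegral.integral_comp_sub_left (a := 0) (b := r) (fun s => s * g s) r
    simpa [hsymm] using h
  have hsub : ∫ s in (0 : ℝ)..r, (r - s) * g s =
      r * (∫ s in (0 : ℝ)..r, g s) - ∫ s in (0 : ℝ)..r, s * g s := by
    rw [← intervalIntegral.integral_const_mul, ← intervalIntegral.integral_sub (hg.const_mul r) hid]
    simp only [sub_mul]
  linarith

theorem ae_comp_sub_left {p : ℝ → Prop} (h : ∀ᵐ u, p u) (r : ℝ) : ∀ᵐ s, p (r - s) :=
  (Measure.measurePreserving_sub_left volume r).quasiMeasurePreserving.ae h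

theorem ae_comp_sub_right {p : ℝ → Prop} (h : ∀ᵐ u, p u) (r : ℝ) : ∀ᵐ s, p (s - r) :=
  (measurePreserving_sub_right volume r).quasiMeasurePreserving.ae h

theorem integral_Ioi_eq_integral_Ioc_add {g : ℝ → ℝ} {a b : ℝ} (hg : IntegrableOn g (Ioi a))
    (hab : a ≤ b) : ∫ s in Ioi a, g s = (∫ s in Ioc a b, g s) + ∫ s in Ioi b, g s := by
  rw [← Ioc_union_Ioi_eq_Ioi hab]
  exact setIntegral_union (Ioc_disjoint_Ioi le_rfl) measurableSet_Ioi
    (hg.mono_set Ioc_subset_Ioi_self) (hg.mono_set (Ioi_subset_Ioi hab))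

theorem lm_natCast (f : ℝ → ℝ) (k : ℕ) : lm f k = ∫ r in Ioi (0 : ℝ), f r * r ^ k := by
  simp only [lm, rpow_natCast]

theorem integral_Kker_sub (r : ℝ) : ∫ s in (0 : ℝ)..r, Kker s (r - s) = r ^ 7 / 30 := by
  have h : ∀ s, Kker s (r - s) = r ^ 4 * s ^ 2 - 2 * r ^ 3 * s ^ 3 + r ^ 2 * s ^ 4 := by
    intro s; unfold Kker; ring
  simp only [h]
  rw [intervalIntegral.integral_add (Continuous.intervalIntegrable (by fun_prop) _ _)
      (Continuous.intervalIntegrable (by fun_prop) _ _),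
    intervalIntegral.integral_sub (Continuous.intervalIntegrable (by fun_prop) _ _)
      (Continuous.intervalIntegrable (by fun_prop) _ _)]
  simp only [intervalIntegral.integral_const_mul, integral_pow]
  norm_num
  ring

section

variable {f : ℝ → ℝ} {M r : ℝ}

/-- Gain from coalescence. -/
theorem integral_Kker_mul_mul_sub_le (hfmeas : Measurable f) (hf0 : ∀ r, 0 ≤ f r)
    (hm3 : IntegrableOn (fun s => f s * s ^ 3) (Ioi (0 : ℝ)))
    (hM : ∀ᵐ u : ℝ, 0 < u → f u * u ^ 2 ≤ M) (hr : 0 < r) :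
    ∫ s in (0 : ℝ)..r, Kker s (r - s) * f s * f (r - s) ≤
      2 * r * M * ∫ s in Ioc 0 r, f s * s ^ 3 := by
  have hM' := ae_comp_sub_left hM r
  have hint : IntervalIntegrable (fun s => Kker s (r - s) * f s * f (r - s)) volume 0 r := by
    rw [intervalIntegrable_iff_integrableOn_Ioo_of_le hr.le]
    refine Measure.integrableOn_of_bounded (M := r ^ 2 * (M * M)) (by simp)
      (by unfold Kker; fun_prop) ?_
    filter_upwards [ae_restrict_of_ae hM, ae_restrict_of_ae hM',
      ae_restrict_mem measurableSet_Ioo] with s h1 h2 hs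
    have h1 := h1 hs.1
    have h2 := h2 (sub_pos.2 hs.2)
    have e : Kker s (r - s) * f s * f (r - s) =
        r ^ 2 * ((f s * s ^ 2) * (f (r - s) * (r - s) ^ 2)) := by unfold Kker; ring
    have p1 : 0 ≤ f s * s ^ 2 := mul_nonneg (hf0 _) (sq_nonneg _)
    have p2 : 0 ≤ f (r - s) * (r - s) ^ 2 := mul_nonneg (hf0 _) (sq_nonneg _)
    rw [e, norm_of_nonneg (by positivity)]
    gcongr
    exact p1.trans h1
  have key := mul_integral_eq_two_mul_integral_id_mul_of_symm hint (by
    intro s; simp only [Kker, sub_sub_cancel]; ring)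
  have hle : ∫ s in (0 : ℝ)..r, s * (Kker s (r - s) * f s * f (r - s)) ≤
      r ^ 2 * M * ∫ s in Ioc 0 r, f s * s ^ 3 := by
    rw [intervalIntegral.integral_of_le hr.le, ← integral_const_mul,
      integral_Ioc_eq_integral_Ioo, integral_Ioc_eq_integral_Ioo]
    refine integral_mono_of_nonneg ?_
      ((hm3.mono_set Ioo_subset_Ioi_self).const_mul _) ?_
    · filter_upwards [ae_restrict_mem measurableSet_Ioo] with s hs
      have := hf0 s
      have := hf0 (r - s)
      have := hs.1
      simp only [Kker, Pi.zero_apply]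
      positivity
    · filter_upwards [ae_restrict_of_ae hM', ae_restrict_mem measurableSet_Ioo] with s h2 hs
      have h2 := h2 (sub_pos.2 hs.2)
      have p1 : 0 ≤ r ^ 2 * (f s * s ^ 3) :=
        mul_nonneg (sq_nonneg _) (mul_nonneg (hf0 _) (pow_nonneg hs.1.le _))
      have := mul_le_mul_of_nonneg_left h2 p1
      unfold Kker
      linarith
  refine le_of_mul_le_mul_left ?_ hr
  linarith

/-- Gain from splitting of larger particles. -/
theorem integral_Ioi_Kker_mul_mul_sub_le (hf0 : ∀ r, 0 ≤ f r)
    (hm3 : IntegrableOn (fun s => f s * s ^ 3) (Ioi (0 : ℝ)))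
    (hM : ∀ᵐ u : ℝ, 0 < u → f u * u ^ 2 ≤ M) (hr : 0 < r) :
    ∫ s in Ioi r, Kker r (s - r) * f s * f (s - r) ≤
      r * M * ∫ s in Ioi r, f s * s ^ 3 := by
  rw [← integral_const_mul]
  refine integral_mono_of_nonneg ?_
    ((hm3.mono_set (Ioi_subset_Ioi hr.le)).const_mul _) ?_
  · refine Eventually.of_forall fun s => ?_
    have := hf0 s
    have := hf0 (s - r)
    simp only [Kker, Pi.zero_apply]
    positivity
  · filter_upwards [ae_restrict_of_ae (ae_comp_sub_right hM r),
      ae_restrict_mem measurableSet_Ioi] with s h hs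
    have hs : r < s := hs
    have h := h (sub_pos.2 hs)
    have hs0 : 0 < s := hr.trans hs
    have hfs := hf0 s
    have hfr := hf0 (s - r)
    calc Kker r (s - r) * f s * f (s - r)
        = (r * (f s * s ^ 2) * r) * (f (s - r) * (s - r) ^ 2) := by unfold Kker; ring
      _ ≤ (r * (f s * s ^ 2) * s) * M := by gcongr
      _ = r * M * (f s * s ^ 3) := by ring

theorem integrableOn_mul_sq (hfmeas : Measurable f) (hf0 : ∀ r, 0 ≤ f r)
    (hm4 : IntegrableOn (fun s => f s * s ^ 4) (Ioi (0 : ℝ)))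
    (hM : ∀ᵐ u : ℝ, 0 < u → f u * u ^ 2 ≤ M) :
    IntegrableOn (fun s => f s * s ^ 2) (Ioi (0 : ℝ)) := by
  rw [← Ioc_union_Ioi_eq_Ioi zero_le_one]
  refine IntegrableOn.union ?_ ?_
  · refine Measure.integrableOn_of_bounded (M := M) (by simp) (by fun_prop) ?_
    filter_upwards [ae_restrict_of_ae hM, ae_restrict_mem measurableSet_Ioc] with s h hs
    rw [norm_of_nonneg (mul_nonneg (hf0 _) (sq_nonneg _))]
    exact h hs.1
  · refine (hm4.mono_set (Ioi_subset_Ioi zero_le_one)).mono' (by fun_prop) ?_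
    filter_upwards [ae_restrict_mem measurableSet_Ioi] with s hs
    have hs : 1 < s := hs
    rw [norm_of_nonneg (mul_nonneg (hf0 _) (sq_nonneg _))]
    exact mul_le_mul_of_nonneg_left (pow_le_pow_right₀ hs.le (by norm_num)) (hf0 s)

/-- Net loss coefficient; the last line of `Qq`. -/
theorem integral_Kker_loss_le (hf0 : ∀ r, 0 ≤ f r)
    (hm2 : IntegrableOn (fun s => f s * s ^ 2) (Ioi (0 : ℝ)))
    (hm3 : IntegrableOn (fun s => f s * s ^ 3) (Ioi (0 : ℝ)))
    (hm4 : IntegrableOn (fun s => f s * s ^ 4) (Ioi (0 : ℝ))) (hr : 0 < r) :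
    (∫ s in Ioi r, Kker r (s - r) * f s) - (∫ s in (0 : ℝ)..r, Kker s (r - s) * f s) -
      (∫ s in Ioi (0 : ℝ), Kker r s * f s) ≤ -(2 * r ^ 3 * ∫ s in Ioi 0, f s * s ^ 3) := by
  have poly (c : ℝ) :
      IntegrableOn (fun s => (r + c * s) ^ 2 * r ^ 2 * s ^ 2 * f s) (Ioi 0) := by
    refine (((hm2.const_mul (r ^ 4)).add (hm3.const_mul (2 * c * r ^ 3))).add
      (hm4.const_mul (c ^ 2 * r ^ 2))).congr (Eventually.of_forall fun s => ?_)
    simp only [Pi.add_apply]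
    ring
  have hsum : IntegrableOn (fun s => Kker r s * f s) (Ioi 0) :=
    (poly 1).congr (Eventually.of_forall fun s => by simp only [Kker]; ring)
  have hdiff : IntegrableOn (fun s => Kker r (s - r) * f s) (Ioi 0) :=
    (poly (-1)).congr (Eventually.of_forall fun s => by simp only [Kker]; ring)
  have hlow : 0 ≤ ∫ s in (0 : ℝ)..r, Kker s (r - s) * f s :=
    intervalIntegral.integral_nonneg hr.le fun s _ =>
      mul_nonneg (by unfold Kker; positivity) (hf0 s)
  have hI : (2 * r ^ 3 * ∫ s in Ioc 0 r, f s * s ^ 3) ≤ ∫ s in Ioc 0 r, Kker r s * f s := by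
    rw [← integral_const_mul]
    refine setIntegral_mono_on ((hm3.mono_set Ioc_subset_Ioi_self).const_mul _)
      (hsum.mono_set Ioc_subset_Ioi_self) measurableSet_Ioc fun s hs => ?_
    have : 0 ≤ r ^ 2 * s ^ 2 * f s * (r ^ 2 + s ^ 2) := by
      have := hf0 s; positivity
    unfold Kker
    linarith
  have hJ : (2 * r ^ 3 * ∫ s in Ioi r, f s * s ^ 3) ≤
      (∫ s in Ioi r, Kker r s * f s) - ∫ s in Ioi r, Kker r (s - r) * f s := by
    have hsub := Ioi_subset_Ioi hr.le
    rw [← integral_const_mul, ← integral_sub (hsum.mono_set hsub) (hdiff.mono_set hsub)]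
    refine setIntegral_mono_on ((hm3.mono_set hsub).const_mul _)
      ((hsum.mono_set hsub).sub (hdiff.mono_set hsub)) measurableSet_Ioi fun s hs => ?_
    have hs0 : 0 < s := hr.trans hs
    have : 0 ≤ r ^ 3 * (f s * s ^ 3) := by
      have := hf0 s; positivity
    unfold Kker
    linarith
  rw [integral_Ioi_eq_integral_Ioc_add hm3 hr.le, integral_Ioi_eq_integral_Ioc_add hsum hr.le]
  linarith

theorem integral_Ioi_Kker_mul_le (hf0 : ∀ r, 0 ≤ f r)
    (hm4 : IntegrableOn (fun s => f s * s ^ 4) (Ioi (0 : ℝ))) (hr : 0 < r) :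
    ∫ s in Ioi r, Kker r (s - r) * f s ≤ r ^ 2 * ∫ s in Ioi 0, f s * s ^ 4 := by
  have hsub := Ioi_subset_Ioi hr.le
  have hnn : ∀ s, 0 ≤ f s * s ^ 4 := fun s => by
    have := hf0 s; positivity
  calc ∫ s in Ioi r, Kker r (s - r) * f s ≤ ∫ s in Ioi r, r ^ 2 * (f s * s ^ 4) := by
        refine integral_mono_of_nonneg (Eventually.of_forall fun s =>
          mul_nonneg (by unfold Kker; positivity) (hf0 s)) ((hm4.mono_set hsub).const_mul _) ?_
        filter_upwards [ae_restrict_mem measurableSet_Ioi] with s hs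
        have hs : r < s := hs
        have hfs := hf0 s
        have hsq : (s - r) ^ 2 ≤ s ^ 2 := by
          gcongr
          linarith
        calc Kker r (s - r) * f s = r ^ 2 * (f s * s ^ 2 * (s - r) ^ 2) := by unfold Kker; ring
          _ ≤ r ^ 2 * (f s * s ^ 2 * s ^ 2) := by gcongr
          _ = r ^ 2 * (f s * s ^ 4) := by ring
    _ = r ^ 2 * ∫ s in Ioi r, f s * s ^ 4 := integral_const_mul _ _
    _ ≤ r ^ 2 * ∫ s in Ioi 0, f s * s ^ 4 := by
        gcongr
        exact Eventually.of_forall hnn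

end

/-- Pointwise bounds on the collision operator. -/
theorem pointwise_collision_bounds (f : ℝ → ℝ) (hfmeas : Measurable f) (hf0 : ∀ r, 0 ≤ f r)
    (hm3 : IntegrableOn (fun r => f r * r ^ (3 : ℝ)) (Ioi (0 : ℝ)))
    (hm4 : IntegrableOn (fun r => f r * r ^ (4 : ℝ)) (Ioi (0 : ℝ)))
    (hbd : ∃ B : ℝ, ∀ᵐ r ∂(volume.restrict (Ioi (0 : ℝ))), f r * r ^ 2 ≤ B) :
    ∀ᵐ r ∂(volume.restrict (Ioi (0 : ℝ))),
      (Qq f r ≤ 8 * π ^ 2 *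
        (2 * lm f 3 * r * essSup (fun s => f s * s ^ 2) (volume.restrict (Ioi (0 : ℝ))) -
          4 * lm f 3 * (r ^ 3 * f r))) ∧
      (Lop f r ≤ 8 * π ^ 2 * (2 * lm f 4 * r ^ 2 - (1 / 30 : ℝ) * (r ^ 7 * f r))) := by
  set M := essSup (fun s => f s * s ^ 2) (volume.restrict (Ioi (0 : ℝ)))
  have hM : ∀ᵐ u : ℝ, 0 < u → f u * u ^ 2 ≤ M :=
    (ae_restrict_iff' measurableSet_Ioi).1
      (ae_le_essSup (isBoundedUnder_of_eventually_le hbd.choose_spec))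
  have e3 : lm f 3 = ∫ r in Ioi (0 : ℝ), f r * r ^ 3 := mod_cast lm_natCast f 3
  have e4 : lm f 4 = ∫ r in Ioi (0 : ℝ), f r * r ^ 4 := mod_cast lm_natCast f 4
  replace hm3 : IntegrableOn (fun r => f r * r ^ 3) (Ioi (0 : ℝ)) := mod_cast hm3
  replace hm4 : IntegrableOn (fun r => f r * r ^ 4) (Ioi (0 : ℝ)) := mod_cast hm4
  have hm2 := integrableOn_mul_sq hfmeas hf0 hm4 hM
  filter_upwards [ae_restrict_mem measurableSet_Ioi] with r hr
  replace hr : 0 < r := hr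
  constructor
  · have hA := integral_Kker_mul_mul_sub_le hfmeas hf0 hm3 hM hr
    have hB := integral_Ioi_Kker_mul_mul_sub_le hf0 hm3 hM hr
    have hC := mul_le_mul_of_nonneg_left (integral_Kker_loss_le hf0 hm2 hm3 hm4 hr) (hf0 r)
    have hgain : 2 * lm f 3 * r * M = 2 * r * M * (∫ s in Ioc 0 r, f s * s ^ 3) +
        2 * (r * M * ∫ s in Ioi r, f s * s ^ 3) := by
      rw [e3, integral_Ioi_eq_integral_Ioc_add hm3 hr.le]; ring
    unfold Qq
    refine mul_le_mul_of_nonneg_left ?_ (by positivity)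
    rw [hgain, e3]
    linarith
  · have h := integral_Ioi_Kker_mul_le hf0 hm4 hr
    unfold Lop
    refine mul_le_mul_of_nonneg_left ?_ (by positivity)
    rw [integral_Kker_sub, e4]
    linarith
end
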